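/- Let G be a finite simple graph with at least one edge, let c ≥ 1 be a real number, and suppose k̂ : V → ℕ is a c-approximate core-number assignment, i.e., k(v)/c ≤ k̂(v) ≤ c·k(v) for every vertex v, where k(v) is the coreness of v. Let k̂_max = max_{v ∈ V} k̂(v). Then ρ* ≥ k̂_max/(2c), and consequently every densest subgraph S* of G is contained in the ⌈k̂_max/(2c)⌉-core of G. -/

import Mathlib

open Finset
open scoped Classical

variable {V : Type*}

/-- `degS G S v` is the degree of `v` in the subgraph of `G` induced by the vertex set `S`. -/
noncomputable def degS [Fintype V] (G : SimpleGraph V) (S : Finset V) (v : V) : ℕ :=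
  (S.filter fun u => G.Adj v u).card

/-- `edgeCount G S` is the number of edges of the subgraph of `G` induced by `S`. -/
noncomputable def edgeCount [Fintype V] (G : SimpleGraph V) (S : Finset V) : ℕ :=
  (G.edgeFinset.filter fun ed => ∀ v ∈ ed, v ∈ S).card

/-- `density G S` is the density `|E(G[S])| / |S|` of the induced subgraph `G[S]`, as a rational. -/
noncomputable def density [Fintype V] (G : SimpleGraph V) (S : Finset V) : ℚ :=
  (edgeCount G S : ℚ) / (S.card : ℚ)

theorem edgeCount_insert_aux [Fintype V] (G : SimpleGraph V) (S : Finset V) (v : V) (hv : v ∉ S) :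
    edgeCount G (insert v S) = edgeCount G S + degS G S v := by
  have h : (G.edgeFinset.filter fun ed => ∀ w ∈ ed, w ∈ insert v S)
      = (G.edgeFinset.filter fun ed => ∀ w ∈ ed, w ∈ S) ∪
        (S.filter fun u => G.Adj v u).image (fun u => s(v, u)) := by
    ext e
    induction e using Sym2.ind with
    | _ a b =>
      simp only [mem_filter, mem_union, mem_image, SimpleGraph.mem_edgeFinset,
        SimpleGraph.mem_edgeSet, Sym2.mem_iff, forall_eq_or_imp, forall_eq, mem_insert,
        Sym2.eq_iff]
      constructor
      · rintro ⟨hab, ha | ha, hb | hb⟩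
        · subst ha; subst hb; exact absurd hab (G.irrefl)
        · subst ha; exact Or.inr ⟨b, ⟨hb, hab⟩, Or.inl ⟨rfl, rfl⟩⟩
        · subst hb; exact Or.inr ⟨a, ⟨ha, hab.symm⟩, Or.inr ⟨rfl, rfl⟩⟩
        · exact Or.inl ⟨hab, ha, hb⟩
      · rintro (⟨hab, ha, hb⟩ | ⟨u, ⟨hu, hvu⟩, ⟨rfl, rfl⟩ | ⟨rfl, rfl⟩⟩)
        · exact ⟨hab, Or.inr ha, Or.inr hb⟩
        · exact ⟨hvu, Or.inl rfl, Or.inr hu⟩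
        · exact ⟨hvu.symm, Or.inr hu, Or.inl rfl⟩
  unfold edgeCount degS
  rw [h, card_union_of_disjoint, card_image_of_injective]
  · intro x y hxy
    exact Sym2.congr_right.1 hxy
  · rw [Finset.disjoint_left]
    intro e he he'
    obtain ⟨u, -, rfl⟩ := mem_image.1 he'
    exact hv ((mem_filter.1 he).2 v (Sym2.mem_mk_left v u))

theorem degS_insert_aux [Fintype V] (G : SimpleGraph V) (S : Finset V) (v w : V) (hv : v ∉ S) :
    degS G (insert v S) w = degS G S w + if G.Adj v w then 1 else 0 := by
  unfold degS
  rw [filter_insert]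
  by_cases h : G.Adj w v
  · rw [if_pos h, if_pos h.symm, card_insert_of_notMem]
    simp [hv]
  · rw [if_neg h, if_neg (fun h' => h h'.symm)]; rfl

theorem handshake_aux [Fintype V] (G : SimpleGraph V) (S : Finset V) :
    ∑ v ∈ S, degS G S v = 2 * edgeCount G S := by
  induction S using Finset.induction_on with
  | empty =>
    have : edgeCount G ∅ = 0 := by
      unfold edgeCount
      rw [card_eq_zero, filter_eq_empty_iff]
      intro e _ h
      induction e using Sym2.ind with
      | _ a b => simpa using h a (Sym2.mem_mk_left a b)
    simp [this]
  | insert v S hv ih =>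
    rw [sum_insert hv, edgeCount_insert_aux G S v hv,
      sum_congr rfl (fun w _ => degS_insert_aux G S v w hv), sum_add_distrib, ih,
      degS_insert_aux G S v v hv, ← card_filter]
    simp only [SimpleGraph.irrefl, if_false]
    change degS G S v + 0 + (2 * edgeCount G S + degS G S v) = _
    ring

theorem degS_mono_aux [Fintype V] (G : SimpleGraph V) {S T : Finset V} (h : S ⊆ T) (v : V) :
    degS G S v ≤ degS G T v :=
  card_le_card (filter_subset_filter _ h)

theorem density_le_degS_aux [Fintype V] (G : SimpleGraph V) (S : Finset V)
    (hmaxd : ∀ T : Finset V, T.Nonempty → density G T ≤ density G S) (v : V) (hv : v ∈ S) :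
    density G S ≤ (degS G S v : ℚ) := by
  obtain ⟨T, hT, rfl⟩ : ∃ T, v ∉ T ∧ insert v T = S := ⟨S.erase v, by simp, insert_erase hv⟩
  have h1 : (edgeCount G T : ℚ) ≤ density G (insert v T) * T.card := by
    rcases T.eq_empty_or_nonempty with rfl | hne
    · have := handshake_aux G ∅
      simp at this
      simp [this]
    · have := hmaxd T hne
      have hp : (0 : ℚ) < T.card := by exact_mod_cast hne.card_pos
      rwa [density, div_le_iff₀ hp] at this
  have h2 : density G (insert v T) * (T.card + 1) = edgeCount G T + degS G T v := by
    have hp : (T.card + 1 : ℚ) ≠ 0 := by positivity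
    rw [density, card_insert_of_notMem hT, edgeCount_insert_aux G T v hT]
    push_cast
    field_simp
  have h3 : (degS G T v : ℚ) ≤ degS G (insert v T) v := by
    exact_mod_cast degS_mono_aux G (subset_insert v T) v
  linarith

/-- For a `c`-approximate core-number assignment `khat` with maximum value `khatmax`,
we have `ρ* ≥ khatmax/(2c)`, and every densest subgraph is contained in the
`⌈khatmax/(2c)⌉`-core of `G`. -/
theorem apx_core_prune_preserves_densest
    [Fintype V] (G : SimpleGraph V) (hE : ∃ u v : V, G.Adj u v)
    (c : ℝ) (hc : 1 ≤ c)
    (kfun : V → ℕ)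
    (hkfun : ∀ v : V,
      (∃ C : Finset V, v ∈ C ∧ ∀ w ∈ C, kfun v ≤ degS G C w) ∧
      (∀ k : ℕ, (∃ C : Finset V, v ∈ C ∧ ∀ w ∈ C, k ≤ degS G C w) → k ≤ kfun v))
    (khat : V → ℕ)
    (hkhat : ∀ v : V, (kfun v : ℝ) / c ≤ (khat v : ℝ) ∧ (khat v : ℝ) ≤ c * (kfun v : ℝ))
    (khatmax : ℕ)
    (hmax1 : ∃ v : V, khat v = khatmax) (hmax2 : ∀ v : V, khat v ≤ khatmax)
    (Sstar : Finset V) (hne : Sstar.Nonempty)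
    (hmaxd : ∀ S : Finset V, S.Nonempty → density G S ≤ density G Sstar)
    (C : Finset V)
    (hC : ∀ v ∈ C, ⌈(khatmax : ℝ) / (2 * c)⌉ ≤ (degS G C v : ℤ))
    (hCmax : ∀ T : Finset V,
      (∀ v ∈ T, ⌈(khatmax : ℝ) / (2 * c)⌉ ≤ (degS G T v : ℤ)) → C ⊆ T → T = C) :
    (khatmax : ℝ) / (2 * c) ≤ ((density G Sstar : ℚ) : ℝ) ∧ Sstar ⊆ C := by
  have hc0 : (0 : ℝ) < c := by linarith
  have key : (khatmax : ℝ) / (2 * c) ≤ ((density G Sstar : ℚ) : ℝ) := by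
    obtain ⟨v, rfl⟩ := hmax1
    obtain ⟨D, hvD, hD⟩ := (hkfun v).1
    have hp : (0 : ℚ) < D.card := by exact_mod_cast card_pos.2 ⟨v, hvD⟩
    have h1 : D.card * kfun v ≤ 2 * edgeCount G D := by
      rw [← handshake_aux]
      simpa using card_nsmul_le_sum D (degS G D) (kfun v) hD
    have h1' : (D.card * kfun v : ℚ) ≤ 2 * edgeCount G D := by exact_mod_cast h1
    have h2 : (kfun v : ℚ) / 2 ≤ density G D := by
      rw [density, le_div_iff₀ hp]
      linarith
    have h3 := h2.trans (hmaxd D ⟨v, hvD⟩)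
    have h4 : (kfun v : ℝ) / 2 ≤ ((density G Sstar : ℚ) : ℝ) := by
      have h3' : (((kfun v : ℚ) / 2 : ℚ) : ℝ) ≤ ((density G Sstar : ℚ) : ℝ) := Rat.cast_le.2 h3
      push_cast at h3'
      exact h3'
    refine le_trans ?_ h4
    rw [div_le_iff₀ (by positivity)]
    linarith [(hkhat v).2]
  refine ⟨key, ?_⟩
  have h := hCmax (C ∪ Sstar) (fun v hv => ?_) subset_union_left
  · rw [← h]
    exact subset_union_right
  · rcases mem_union.1 hv with hv | hv
    · exact (hC v hv).trans (by exact_mod_cast degS_mono_aux G subset_union_left v)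
    · have h5 : ((density G Sstar : ℚ) : ℝ) ≤ (degS G Sstar v : ℝ) := by
        exact_mod_cast density_le_degS_aux G Sstar hmaxd v hv
      have h6 : ⌈(khatmax : ℝ) / (2 * c)⌉ ≤ (degS G Sstar v : ℤ) := by
        rw [Int.ceil_le]
        exact_mod_cast key.trans h5
      exact h6.trans (by exact_mod_cast degS_mono_aux G subset_union_right v)
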